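/- arXiv:2501.04396 — 4 statements merged into one kernel-verified Lean document; each statement's English description precedes it below -/
import Mathlib

section
/- Let n be a positive integer, r > 0, and let m = (m_p)_{p≥0} be a sequence of positive real numbers with m_0 = 1 satisfying Assumption (A). Let A(z) be an n×n matrix whose entries are holomorphic functions on the disc D(0,r), and let y_0 ∈ ℂ^n. Then the Cauchy problem ∂_m y = A(z) y, y(0) = y_0, admits a unique solution y = (y_1,…,y_n), and each component y_j is holomorphic on the whole disc D(0,r). -/
open Filter

/-- The coefficients of the formal solution of `∂ₘ y = A(z) y`, `y(0) = y₀`. -/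
noncomputable def momentSolCoef (m : ℕ → ℝ) {n : ℕ} (A : ℕ → Matrix (Fin n) (Fin n) ℂ)
    (y₀ : Fin n → ℂ) : ℕ → Fin n → ℂ
  | 0 => y₀
  | p + 1 => ((m (p + 1) / m p : ℝ) : ℂ)⁻¹ •
      ∑ k : Fin (p + 1), (A (p - k)).mulVec (momentSolCoef m A y₀ k)
  decreasing_by exact k.2

theorem momentSolCoef_zero (m : ℕ → ℝ) {n : ℕ} (A : ℕ → Matrix (Fin n) (Fin n) ℂ)
    (y₀ : Fin n → ℂ) : momentSolCoef m A y₀ 0 = y₀ := by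
  rw [momentSolCoef]

theorem momentSolCoef_succ {m : ℕ → ℝ} (hm : ∀ p, 0 < m p) {n : ℕ}
    (A : ℕ → Matrix (Fin n) (Fin n) ℂ) (y₀ : Fin n → ℂ) (p : ℕ) :
    ((m (p + 1) / m p : ℝ) : ℂ) • momentSolCoef m A y₀ (p + 1) =
      ∑ k ∈ Finset.range (p + 1), (A (p - k)).mulVec (momentSolCoef m A y₀ k) := by
  have h : ((m (p + 1) / m p : ℝ) : ℂ) ≠ 0 :=
    Complex.ofReal_ne_zero.2 (div_pos (hm _) (hm _)).ne'
  rw [momentSolCoef, smul_inv_smul₀ h,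
    Finset.sum_range fun k => (A (p - k)).mulVec (momentSolCoef m A y₀ k)]

/-- The moment recursion determines its solution from the initial value. -/
theorem moment_recursion_unique {m : ℕ → ℝ} (hm : ∀ p, 0 < m p) {n : ℕ}
    {A : ℕ → Matrix (Fin n) (Fin n) ℂ} {c d : ℕ → Fin n → ℂ} (h0 : c 0 = d 0)
    (hc : ∀ p : ℕ, ((m (p + 1) / m p : ℝ) : ℂ) • c (p + 1) =
      ∑ k ∈ Finset.range (p + 1), (A (p - k)).mulVec (c k))
    (hd : ∀ p : ℕ, ((m (p + 1) / m p : ℝ) : ℂ) • d (p + 1) =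
      ∑ k ∈ Finset.range (p + 1), (A (p - k)).mulVec (d k)) : c = d := by
  funext p
  induction p using Nat.strong_induction_on with
  | _ p ih =>
    cases p with
    | zero => exact h0
    | succ p =>
      have h : ((m (p + 1) / m p : ℝ) : ℂ) ≠ 0 :=
        Complex.ofReal_ne_zero.2 (div_pos (hm _) (hm _)).ne'
      apply smul_right_injective _ h
      simp only [hc, hd]
      exact Finset.sum_congr rfl fun k hk => by rw [ih k (Finset.mem_range.1 hk)]

theorem norm_mulVec_le_of_entries_le {n : ℕ} {B : Matrix (Fin n) (Fin n) ℂ} {K : ℝ}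
    (hK : 0 ≤ K) (hB : ∀ i j, ‖B i j‖ ≤ K) (v : Fin n → ℂ) :
    ‖B.mulVec v‖ ≤ n * K * ‖v‖ := by
  refine (pi_norm_le_iff_of_nonneg (by positivity)).2 fun i => ?_
  calc ‖B.mulVec v i‖ ≤ ∑ j, ‖B i j * v j‖ :=
        norm_sum_le Finset.univ fun j => B i j * v j
    _ ≤ ∑ _j : Fin n, K * ‖v‖ := Finset.sum_le_sum fun j _ => by
        rw [norm_mul]
        exact mul_le_mul (hB i j) (norm_le_pi_norm v j) (norm_nonneg _) hK
    _ = n * K * ‖v‖ := by simp [mul_assoc]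

/-- A sequence controlled by `L / (p + 1)` times its partial sums grows subexponentially. -/
theorem summable_mul_pow_of_le_partial_sum {u : ℕ → ℝ} {L q : ℝ} (hu : ∀ p, 0 ≤ u p)
    (hq0 : 0 ≤ q) (hq1 : q < 1)
    (h : ∀ p : ℕ, u (p + 1) ≤ L / (p + 1) * ∑ k ∈ Finset.range (p + 1), u k) :
    Summable fun p => u p * q ^ p := by
  have hS : ∀ p, 0 ≤ ∑ k ∈ Finset.range (p + 1), u k := fun p =>
    Finset.sum_nonneg fun k _ => hu k
  have hlim : Tendsto (fun p : ℕ => (1 + L / ((p : ℝ) + 1)) * q) atTop (nhds q) := by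
    have h1 : Tendsto (fun p : ℕ => L / ((p : ℝ) + 1)) atTop (nhds 0) :=
      tendsto_const_nhds.div_atTop (tendsto_natCast_atTop_atTop.atTop_add tendsto_const_nhds)
    simpa using (h1.const_add 1).mul_const q
  have hsum : Summable fun p => (∑ k ∈ Finset.range (p + 1), u k) * q ^ p := by
    refine summable_of_ratio_norm_eventually_le (r := (1 + q) / 2) (by linarith) ?_
    filter_upwards [hlim.eventually_le_const (show q < (1 + q) / 2 by linarith)] with p hp
    rw [Real.norm_of_nonneg (mul_nonneg (hS _) (by positivity)),
      Real.norm_of_nonneg (mul_nonneg (hS _) (by positivity)), Finset.sum_range_succ]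
    calc (∑ k ∈ Finset.range (p + 1), u k + u (p + 1)) * q ^ (p + 1)
        ≤ (∑ k ∈ Finset.range (p + 1), u k +
            L / (p + 1) * ∑ k ∈ Finset.range (p + 1), u k) * q ^ (p + 1) := by
          gcongr
          exact h p
      _ = (1 + L / (p + 1)) * q * ((∑ k ∈ Finset.range (p + 1), u k) * q ^ p) := by ring
      _ ≤ _ := mul_le_mul_of_nonneg_right hp (mul_nonneg (hS _) (by positivity))
  refine hsum.of_nonneg_of_le (fun p => mul_nonneg (hu p) (by positivity)) fun p => ?_
  gcongr
  exact Finset.single_le_sum (fun k _ => hu k) (Finset.self_mem_range_succ p)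

theorem exists_entries_bound {n : ℕ} {A : ℕ → Matrix (Fin n) (Fin n) ℂ} {R : ℝ} (hR : 0 < R)
    (hA : ∀ i j, Summable fun p => A p i j * (R : ℂ) ^ p) :
    ∃ M, 0 ≤ M ∧ ∀ p i j, ‖A p i j‖ ≤ M / R ^ p := by
  have hb : ∀ i j, ∃ M : ℝ, ∀ p, ‖A p i j * (R : ℂ) ^ p‖ ≤ M := fun i j => by
    obtain ⟨M, hM⟩ := (hA i j).tendsto_atTop_zero.norm.bddAbove_range
    exact ⟨M, fun p => hM ⟨p, rfl⟩⟩
  choose M hM using hb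
  have hM0 : ∀ i j, 0 ≤ M i j := fun i j => (norm_nonneg _).trans (hM i j 0)
  refine ⟨∑ i, ∑ j, M i j, Finset.sum_nonneg fun i _ => Finset.sum_nonneg fun j _ => hM0 i j,
    fun p i j => ?_⟩
  rw [le_div_iff₀ (by positivity)]
  calc ‖A p i j‖ * R ^ p = ‖A p i j * (R : ℂ) ^ p‖ := by simp [abs_of_pos hR]
    _ ≤ M i j := hM i j p
    _ ≤ ∑ j, M i j := Finset.single_le_sum (fun j _ => hM0 i j) (Finset.mem_univ j)
    _ ≤ ∑ i, ∑ j, M i j := Finset.single_le_sum (f := fun i => ∑ j, M i j)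
        (fun i _ => Finset.sum_nonneg fun j _ => hM0 i j) (Finset.mem_univ i)

/-- Under Assumption (A), every formal solution converges absolutely on the disc of
convergence of the matrix `A`. -/
theorem summable_norm_of_moment_recursion {m : ℕ → ℝ} {n : ℕ} {C r : ℝ} (hC : 0 < C)
    (hm : ∀ p : ℕ, ((p : ℝ) + 1) / C ≤ m (p + 1) / m p)
    {A : ℕ → Matrix (Fin n) (Fin n) ℂ}
    (hA : ∀ z ∈ Metric.ball (0 : ℂ) r, ∀ i j, Summable fun p => A p i j * z ^ p)
    {c : ℕ → Fin n → ℂ}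
    (hc : ∀ p : ℕ, ((m (p + 1) / m p : ℝ) : ℂ) • c (p + 1) =
      ∑ k ∈ Finset.range (p + 1), (A (p - k)).mulVec (c k))
    {ρ : ℝ} (hρ0 : 0 ≤ ρ) (hρ : ρ < r) : Summable fun p => ‖c p‖ * ρ ^ p := by
  obtain ⟨R, hρR, hRr⟩ := exists_between hρ
  have hR : 0 < R := hρ0.trans_lt hρR
  obtain ⟨M, hM0, hM⟩ := exists_entries_bound hR
    (hA (R : ℂ) (by simpa [abs_of_pos hR] using hRr))
  have key : ∀ p : ℕ, ‖c (p + 1)‖ * R ^ (p + 1) ≤ (C * (n * M) * R) / (p + 1) *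
      ∑ k ∈ Finset.range (p + 1), ‖c k‖ * R ^ k := by
    intro p
    have h1 : ((p : ℝ) + 1) / C * ‖c (p + 1)‖ ≤
        ∑ k ∈ Finset.range (p + 1), n * (M / R ^ (p - k)) * ‖c k‖ :=
      calc ((p : ℝ) + 1) / C * ‖c (p + 1)‖ ≤ ‖((m (p + 1) / m p : ℝ) : ℂ) • c (p + 1)‖ := by
            rw [norm_smul, Complex.norm_real]
            gcongr
            exact (hm p).trans (le_abs_self _)
        _ ≤ ∑ k ∈ Finset.range (p + 1), ‖(A (p - k)).mulVec (c k)‖ := by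
            rw [hc]
            exact norm_sum_le _ _
        _ ≤ _ := Finset.sum_le_sum fun k _ =>
            norm_mulVec_le_of_entries_le (by positivity) (hM _) _
    have h2 : (∑ k ∈ Finset.range (p + 1), n * (M / R ^ (p - k)) * ‖c k‖) * R ^ p =
        n * M * ∑ k ∈ Finset.range (p + 1), ‖c k‖ * R ^ k := by
      rw [Finset.sum_mul, Finset.mul_sum]
      refine Finset.sum_congr rfl fun k hk => ?_
      have hkp : R ^ p = R ^ (p - k) * R ^ k := by
        rw [← pow_add, Nat.sub_add_cancel (Nat.lt_succ_iff.1 (Finset.mem_range.1 hk))]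
      rw [hkp]
      field_simp
    calc ‖c (p + 1)‖ * R ^ (p + 1)
        = C / (p + 1) * R * ((((p : ℝ) + 1) / C * ‖c (p + 1)‖) * R ^ p) := by
          field_simp
          ring
      _ ≤ C / (p + 1) * R *
          ((∑ k ∈ Finset.range (p + 1), n * (M / R ^ (p - k)) * ‖c k‖) * R ^ p) := by
          gcongr
      _ = _ := by
          rw [h2]
          ring
  refine (summable_mul_pow_of_le_partial_sum (u := fun p => ‖c p‖ * R ^ p)
    (fun p => by positivity)
    (div_nonneg hρ0 hR.le) ((div_lt_one hR).2 hρR) key).congr fun p => ?_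
  rw [div_pow]
  field_simp

/-- A power series converging absolutely at every radius below `r` has an analytic sum on
the disc of radius `r`. -/
theorem analyticOnNhd_tsum_mul_pow {a : ℕ → ℂ} {r : ℝ}
    (ha : ∀ ρ : ℝ, 0 ≤ ρ → ρ < r → Summable fun p => ‖a p‖ * ρ ^ p) :
    AnalyticOnNhd ℂ (fun z => ∑' p, a p * z ^ p) (Metric.ball (0 : ℂ) r) := by
  intro z hz
  obtain ⟨ρ, hzρ, hρr⟩ := exists_between (mem_ball_zero_iff.1 hz)
  have hρ : 0 ≤ ρ := (norm_nonneg z).trans hzρ.le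
  lift ρ to NNReal using hρ
  have hrad : (ρ : ENNReal) ≤ (FormalMultilinearSeries.ofScalars ℂ a).radius := by
    apply FormalMultilinearSeries.le_radius_of_summable_norm
    simpa [FormalMultilinearSeries.ofScalars_norm] using ha ρ ρ.2 hρr
  have hz' : z ∈ Metric.eball (0 : ℂ) (FormalMultilinearSeries.ofScalars ℂ a).radius := by
    refine Metric.eball_subset_eball hrad ?_
    rw [Metric.eball_coe]
    simpa using hzρ
  have h := ((FormalMultilinearSeries.ofScalars ℂ a).hasFPowerSeriesOnBall
    (zero_le.trans_lt hz')).analyticOnNhd z hz'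
  refine h.congr (Eventually.of_forall fun w => ?_)
  simp [FormalMultilinearSeries.sum, mul_comm]


open scoped BigOperators

/-- A solution on the disc `D(0,ρ)` of the moment-differential Cauchy problem
`∂ₘ y = A(z) y`, `y(0) = y₀`, described through its Taylor coefficients at the origin:
`y` is a vector of holomorphic functions on `D(0,ρ)` given by power series whose
coefficient vectors `c p` satisfy `(m (p+1) / m p) • c (p+1) = ∑_{k=0}^p A_{p-k} (c k)`
and `c 0 = y₀`. -/
def IsMomentLinSol (m : ℕ → ℝ) {n : ℕ} (Acoef : ℕ → Matrix (Fin n) (Fin n) ℂ)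
    (y₀ : Fin n → ℂ) (ρ : ℝ) (y : ℂ → Fin n → ℂ) : Prop :=
  ∃ c : ℕ → Fin n → ℂ,
    c 0 = y₀ ∧
    (∀ p : ℕ, ((m (p + 1) / m p : ℝ) : ℂ) • c (p + 1) =
      ∑ k ∈ Finset.range (p + 1), (Acoef (p - k)).mulVec (c k)) ∧
    (∀ z ∈ Metric.ball (0 : ℂ) ρ, ∀ i, HasSum (fun p => c p i * z ^ p) (y z i))

/-- under Assumption (A) on the moment sequence `m`, the Cauchy problem
`∂ₘ y = A(z) y`, `y(0) = y₀`, with `A(z)` holomorphic on `D(0,r)` (given through its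
Taylor coefficients `Acoef`, whose entry series converge on `D(0,r)`), admits a unique
solution, holomorphic on the whole disc `D(0,r)`. -/
theorem statement0 (n : ℕ) (hn : 0 < n) (r : ℝ) (hr : 0 < r)
    (m : ℕ → ℝ) (hmpos : ∀ p, 0 < m p) (hm0 : m 0 = 1)
    (hAssumpA : ∃ C : ℚ, 0 < C ∧ ∀ p : ℕ, 1 ≤ p → (p : ℝ) / (C : ℝ) ≤ m p / m (p - 1))
    (Acoef : ℕ → Matrix (Fin n) (Fin n) ℂ)
    (hAconv : ∀ z ∈ Metric.ball (0 : ℂ) r, ∀ i j, Summable fun p => Acoef p i j * z ^ p)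
    (y₀ : Fin n → ℂ) :
    ∃ y : ℂ → Fin n → ℂ,
      IsMomentLinSol m Acoef y₀ r y ∧
      (∀ i, AnalyticOnNhd ℂ (fun z => y z i) (Metric.ball (0 : ℂ) r)) ∧
      ∀ y' : ℂ → Fin n → ℂ, IsMomentLinSol m Acoef y₀ r y' →
        ∀ z ∈ Metric.ball (0 : ℂ) r, y' z = y z := by
  obtain ⟨C, hC, hCm⟩ := hAssumpA
  have hm : ∀ p : ℕ, ((p : ℝ) + 1) / (C : ℝ) ≤ m (p + 1) / m p := fun p => by
    simpa using hCm (p + 1) (Nat.le_add_left 1 p)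
  set c := momentSolCoef m Acoef y₀
  have hrec := momentSolCoef_succ hmpos Acoef y₀
  have hsum : ∀ i, ∀ ρ : ℝ, 0 ≤ ρ → ρ < r → Summable fun p => ‖c p i‖ * ρ ^ p :=
    fun i ρ hρ0 hρ =>
      (summable_norm_of_moment_recursion (Rat.cast_pos.2 hC) hm hAconv hrec hρ0 hρ).of_nonneg_of_le
        (fun p => by positivity) fun p => by
          gcongr
          exact norm_le_pi_norm (c p) i
  have hhas : ∀ z ∈ Metric.ball (0 : ℂ) r, ∀ i,
      HasSum (fun p => c p i * z ^ p) (∑' p, c p i * z ^ p) := fun z hz i => by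
    refine (Summable.of_norm ?_).hasSum
    simpa using hsum i ‖z‖ (norm_nonneg z) (mem_ball_zero_iff.1 hz)
  refine ⟨fun z i => ∑' p, c p i * z ^ p, ⟨c, momentSolCoef_zero m Acoef y₀, hrec, hhas⟩,
    fun i => analyticOnNhd_tsum_mul_pow (hsum i), ?_⟩
  rintro y' ⟨d, hd0, hd, hdsum⟩ z hz
  have hdc : d = c :=
    moment_recursion_unique hmpos (hd0.trans (momentSolCoef_zero m Acoef y₀).symm) hd hrec
  subst hdc
  exact funext fun i => (hdsum z hz i).unique (hhas z hz i)
end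

section
/- Let n be a positive integer, r > 0, and let m = (m_p)_{p≥0} be a sequence of positive real numbers with m_0 = 1 satisfying Assumption (B). Let A(z) be an n×n matrix and b(z) an n×1 vector whose entries are holomorphic functions on the disc D(0,r), and let y_0 ∈ ℂ^n. Then there exists r_0 with 0 < r_0 ≤ r such that the Cauchy problem ∂_m y = A(z) y + b(z), y(0) = y_0, admits a unique solution y = (y_1,…,y_n) with each component y_j holomorphic on D(0,r_0). -/
open scoped BigOperators

/-- A solution on the disc `D(0,ρ)` of the nonhomogeneous moment-differential Cauchy
problem `∂ₘ y = A(z) y + b(z)`, `y(0) = y₀`, described through its Taylor coefficients: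
`(m (p+1) / m p) • c (p+1) = ∑_{k=0}^p A_{p-k} (c k) + b_p`, `c 0 = y₀`. -/
def IsMomentLinSolNH (m : ℕ → ℝ) {n : ℕ} (Acoef : ℕ → Matrix (Fin n) (Fin n) ℂ)
    (bcoef : ℕ → Fin n → ℂ) (y₀ : Fin n → ℂ) (ρ : ℝ) (y : ℂ → Fin n → ℂ) : Prop :=
  ∃ c : ℕ → Fin n → ℂ,
    c 0 = y₀ ∧
    (∀ p : ℕ, ((m (p + 1) / m p : ℝ) : ℂ) • c (p + 1) =
      (∑ k ∈ Finset.range (p + 1), (Acoef (p - k)).mulVec (c k)) + bcoef p) ∧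
    (∀ z ∈ Metric.ball (0 : ℂ) ρ, ∀ i, HasSum (fun p => c p i * z ^ p) (y z i))

/-- The quotients `Γ(1 + α(p+1)) / Γ(1 + αp)` are bounded below by their first term. -/
theorem Gamma_one_add_le_Gamma_div_Gamma {α : ℝ} (hα : 0 < α) (p : ℕ) :
    Real.Gamma (1 + α) ≤ Real.Gamma (1 + α * (p + 1)) / Real.Gamma (1 + α * p) := by
  have hpos (k : ℕ) : 0 < 1 + α * (k : ℝ) := by positivity
  induction p with
  | zero => simp
  | succ p ih =>
    refine ih.trans ?_
    have h0 := Real.Gamma_pos_of_pos (hpos p)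
    have h1 := Real.Gamma_pos_of_pos (hpos (p + 1))
    have h2 := Real.Gamma_pos_of_pos (hpos (p + 2))
    have hconv := Real.convexOn_log_Gamma.2 (hpos p) (hpos (p + 2))
      (by norm_num : (0 : ℝ) ≤ 1 / 2) (by norm_num : (0 : ℝ) ≤ 1 / 2) (by norm_num)
    have hmid : (1 / 2 : ℝ) • (1 + α * (p : ℝ)) + (1 / 2 : ℝ) • (1 + α * ((p + 2 : ℕ) : ℝ)) =
        1 + α * ((p + 1 : ℕ) : ℝ) := by
      push_cast [smul_eq_mul]; ring
    rw [hmid] at hconv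
    simp only [Function.comp_apply, smul_eq_mul] at hconv
    have hlog : Real.log (Real.Gamma (1 + α * ((p + 1 : ℕ) : ℝ)) ^ 2) ≤
        Real.log (Real.Gamma (1 + α * (p : ℝ)) * Real.Gamma (1 + α * ((p + 2 : ℕ) : ℝ))) := by
      rw [Real.log_pow, Real.log_mul h0.ne' h2.ne']
      push_cast at hconv ⊢
      linarith
    have hsq := (Real.log_le_log_iff (by positivity) (by positivity)).1 hlog
    have hcast : (((p + 1 : ℕ) : ℝ) + 1) = ((p + 2 : ℕ) : ℝ) := by push_cast; ring
    rw [hcast, div_le_div_iff₀ h0 h1]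
    push_cast at hsq ⊢
    linarith

/-- The Taylor coefficients of the solution, computed from the recurrence. -/
noncomputable def momentCoeff (m : ℕ → ℝ) {n : ℕ} (A : ℕ → Matrix (Fin n) (Fin n) ℂ)
    (b : ℕ → Fin n → ℂ) (y₀ : Fin n → ℂ) : ℕ → Fin n → ℂ
  | 0 => y₀
  | p + 1 => ((m (p + 1) / m p : ℝ) : ℂ)⁻¹ •
      ((∑ k : Fin (p + 1), (A (p - k)).mulVec (momentCoeff m A b y₀ k)) + b p)
  decreasing_by exact k.2

theorem eq_momentCoeff_iff {m : ℕ → ℝ} (hm : ∀ p, 0 < m p) {n : ℕ}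
    {A : ℕ → Matrix (Fin n) (Fin n) ℂ} {b : ℕ → Fin n → ℂ} {y₀ : Fin n → ℂ}
    {c : ℕ → Fin n → ℂ} :
    c = momentCoeff m A b y₀ ↔ c 0 = y₀ ∧
      ∀ p : ℕ, ((m (p + 1) / m p : ℝ) : ℂ) • c (p + 1) =
        (∑ k ∈ Finset.range (p + 1), (A (p - k)).mulVec (c k)) + b p := by
  have hne (p : ℕ) : ((m (p + 1) / m p : ℝ) : ℂ) ≠ 0 :=
    Complex.ofReal_ne_zero.2 (div_pos (hm _) (hm _)).ne'
  constructor
  · rintro rfl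
    refine ⟨by rw [momentCoeff], fun p => ?_⟩
    rw [momentCoeff, smul_inv_smul₀ (hne p), Finset.sum_range]
  · rintro ⟨h0, hrec⟩
    funext p
    induction p using Nat.strong_induction_on with
    | _ p ih =>
      cases p with
      | zero => rw [h0, momentCoeff]
      | succ p =>
        rw [momentCoeff, eq_inv_smul_iff₀ (hne p), hrec p, Finset.sum_range]
        congr 1
        exact Finset.sum_congr rfl fun k _ => by rw [ih k k.2]

theorem Summable.exists_norm_le {E : Type*} [SeminormedAddCommGroup E] {f : ℕ → E}
    (hf : Summable f) : ∃ K : ℝ, 0 ≤ K ∧ ∀ p, ‖f p‖ ≤ K := by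
  obtain ⟨K, hK⟩ := hf.tendsto_atTop_zero.norm.bddAbove_range
  exact ⟨K, (norm_nonneg _).trans (hK ⟨0, rfl⟩), fun p => hK ⟨p, rfl⟩⟩

theorem norm_mulVec_le_of_entry_le {n : ℕ} {A : Matrix (Fin n) (Fin n) ℂ} {a : ℝ}
    (ha : 0 ≤ a) (hA : ∀ i j, ‖A i j‖ ≤ a) (v : Fin n → ℂ) :
    ‖A.mulVec v‖ ≤ n * a * ‖v‖ := by
  refine (pi_norm_le_iff_of_nonneg (by positivity)).2 fun i => ?_
  calc ‖A.mulVec v i‖ ≤ ∑ j, ‖A i j * v j‖ := by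
        rw [Matrix.mulVec, dotProduct]
        exact norm_sum_le _ _
    _ ≤ ∑ _j : Fin n, a * ‖v‖ := Finset.sum_le_sum fun j _ => by
        rw [norm_mul]
        exact mul_le_mul (hA i j) (norm_le_pi_norm v j) (norm_nonneg _) ha
    _ = n * a * ‖v‖ := by simp [mul_assoc]

theorem sum_pow_mul_pow_le {q R : ℝ} (hq : 0 < q) (hqR : 2 * q ≤ R) (p : ℕ) :
    ∑ k ∈ Finset.range (p + 1), q ^ (p - k) * R ^ k ≤ 2 * R ^ p := by
  have hR : 0 < R := by linarith
  induction p with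
  | zero => simp
  | succ p ih =>
    rw [Finset.sum_range_succ]
    have hstep : ∑ k ∈ Finset.range (p + 1), q ^ (p + 1 - k) * R ^ k =
        q * ∑ k ∈ Finset.range (p + 1), q ^ (p - k) * R ^ k := by
      rw [Finset.mul_sum]
      refine Finset.sum_congr rfl fun k hk => ?_
      rw [Nat.succ_sub (Nat.lt_succ_iff.1 (Finset.mem_range.1 hk)), pow_succ]
      ring
    rw [hstep, Nat.sub_self, pow_zero, one_mul, pow_succ]
    nlinarith [mul_le_mul_of_nonneg_left ih hq.le, pow_pos hR p,
      mul_le_mul_of_nonneg_right hqR (pow_pos hR p).le]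

/-- If the quotients of `m` are bounded below and the data grow geometrically, then so do the
coefficients of the solution. -/
theorem exists_norm_momentCoeff_le {m : ℕ → ℝ} {δ : ℝ} (hδ : 0 < δ)
    (hm : ∀ p, δ ≤ m (p + 1) / m p) {n : ℕ} {A : ℕ → Matrix (Fin n) (Fin n) ℂ}
    {b : ℕ → Fin n → ℂ} {K q : ℝ} (hK : 0 ≤ K) (hq : 0 < q)
    (hA : ∀ p i j, ‖A p i j‖ ≤ K * q ^ p) (hb : ∀ p, ‖b p‖ ≤ K * q ^ p) (y₀ : Fin n → ℂ) :
    ∃ M R : ℝ, 0 < R ∧ ∀ p, ‖momentCoeff m A b y₀ p‖ ≤ M * R ^ p := by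
  set M : ℝ := 1 + ‖y₀‖
  have hM : 1 ≤ M := le_add_of_nonneg_right (norm_nonneg _)
  set R : ℝ := 2 * q + (2 * n * K + K) / δ
  have hqR : 2 * q ≤ R := le_add_of_nonneg_right (by positivity)
  have hR : 0 < R := by linarith
  have hKR : 2 * n * K + K ≤ δ * R := by
    rw [← div_le_iff₀' hδ]
    exact le_add_of_nonneg_left (by positivity)
  refine ⟨M, R, hR, fun p => ?_⟩
  induction p using Nat.strong_induction_on with
  | _ p ih =>
    cases p with
    | zero => simp [momentCoeff, M]
    | succ p =>
      have hmp : 0 < m (p + 1) / m p := hδ.trans_le (hm p)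
      rw [momentCoeff, norm_smul, norm_inv, Complex.norm_real, Real.norm_of_nonneg hmp.le,
        inv_mul_le_iff₀ hmp]
      have hsum : ‖∑ k : Fin (p + 1), (A (p - k)).mulVec (momentCoeff m A b y₀ k)‖ ≤
          n * K * M * (2 * R ^ p) := by
        calc _ ≤ ∑ k : Fin (p + 1), n * (K * q ^ (p - k : ℕ)) * (M * R ^ (k : ℕ)) :=
              norm_sum_le_of_le _ fun k _ =>
                (norm_mulVec_le_of_entry_le (by positivity) (hA _) _).trans
                  (mul_le_mul_of_nonneg_left (ih k k.2) (by positivity))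
          _ = n * K * M * ∑ k ∈ Finset.range (p + 1), q ^ (p - k) * R ^ k := by
              rw [Finset.sum_range, Finset.mul_sum]
              exact Finset.sum_congr rfl fun k _ => by ring
          _ ≤ _ := mul_le_mul_of_nonneg_left (sum_pow_mul_pow_le hq hqR p) (by positivity)
      have hbp : ‖b p‖ ≤ K * M * R ^ p :=
        (hb p).trans (mul_le_mul (le_mul_of_one_le_right hK hM)
          (pow_le_pow_left₀ hq.le (by linarith) p) (by positivity) (by positivity))
      calc _ ≤ n * K * M * (2 * R ^ p) + K * M * R ^ p := norm_add_le_of_le hsum hbp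
        _ = (2 * n * K + K) * (M * R ^ p) := by ring
        _ ≤ (δ * R) * (M * R ^ p) := mul_le_mul_of_nonneg_right hKR (by positivity)
        _ = δ * (M * R ^ (p + 1)) := by ring
        _ ≤ _ := mul_le_mul_of_nonneg_right (hm p) (by positivity)

/-- under Assumption (B) on the moment sequence `m`, the Cauchy problem
`∂ₘ y = A(z) y + b(z)`, `y(0) = y₀`, with `A(z)` and `b(z)` holomorphic on `D(0,r)`,
admits a unique solution, holomorphic on some disc `D(0,r₀)` with `0 < r₀ ≤ r`. -/
theorem statement6 (n : ℕ) (hn : 0 < n) (r : ℝ) (hr : 0 < r)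
    (m : ℕ → ℝ) (hmpos : ∀ p, 0 < m p) (hm0 : m 0 = 1)
    (hAssumpB : ∃ C : ℝ, 0 < C ∧ ∃ α : ℚ, 0 < α ∧ α < 1 ∧ ∀ p : ℕ, 1 ≤ p →
      (1 / C) * (Real.Gamma (1 + (α : ℝ) * p) / Real.Gamma (1 + (α : ℝ) * ((p : ℝ) - 1))) ≤
        m p / m (p - 1))
    (Acoef : ℕ → Matrix (Fin n) (Fin n) ℂ)
    (hAconv : ∀ z ∈ Metric.ball (0 : ℂ) r, ∀ i j, Summable fun p => Acoef p i j * z ^ p)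
    (bcoef : ℕ → Fin n → ℂ)
    (hbconv : ∀ z ∈ Metric.ball (0 : ℂ) r, ∀ i, Summable fun p => bcoef p i * z ^ p)
    (y₀ : Fin n → ℂ) :
    ∃ r₀ : ℝ, 0 < r₀ ∧ r₀ ≤ r ∧
      ∃ y : ℂ → Fin n → ℂ,
        IsMomentLinSolNH m Acoef bcoef y₀ r₀ y ∧
        (∀ i, AnalyticOnNhd ℂ (fun z => y z i) (Metric.ball (0 : ℂ) r₀)) ∧
        ∀ y' : ℂ → Fin n → ℂ, IsMomentLinSolNH m Acoef bcoef y₀ r₀ y' →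
          ∀ z ∈ Metric.ball (0 : ℂ) r₀, y' z = y z := by
  obtain ⟨C, hC, α, hα, -, hB⟩ := hAssumpB
  have hα' : (0 : ℝ) < α := by exact_mod_cast hα
  have hδ : 0 < 1 / C * Real.Gamma (1 + α) :=
    mul_pos (by positivity) (Real.Gamma_pos_of_pos (by positivity))
  have hm (p : ℕ) : 1 / C * Real.Gamma (1 + α) ≤ m (p + 1) / m p := by
    refine (mul_le_mul_of_nonneg_left (Gamma_one_add_le_Gamma_div_Gamma hα' p)
      (by positivity)).trans ?_
    simpa using hB (p + 1) (by omega)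
  have hs : ((r / 2 : ℝ) : ℂ) ∈ Metric.ball (0 : ℂ) r := by
    rw [mem_ball_zero_iff, Complex.norm_real, Real.norm_of_nonneg (by positivity)]
    linarith
  obtain ⟨K₁, hK₁, hA⟩ := Summable.exists_norm_le
    (f := fun p (i j : Fin n) => Acoef p i j * ((r / 2 : ℝ) : ℂ) ^ p)
    (Pi.summable.2 fun i => Pi.summable.2 fun j => hAconv _ hs i j)
  obtain ⟨K₂, hK₂, hb⟩ := Summable.exists_norm_le
    (f := fun p (i : Fin n) => bcoef p i * ((r / 2 : ℝ) : ℂ) ^ p)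
    (Pi.summable.2 fun i => hbconv _ hs i)
  have hscale {w : ℂ} {p : ℕ} {K : ℝ} (h : ‖w * ((r / 2 : ℝ) : ℂ) ^ p‖ ≤ K) :
      ‖w‖ ≤ K * (r / 2)⁻¹ ^ p := by
    rw [norm_mul, norm_pow, Complex.norm_real, Real.norm_of_nonneg (by positivity)] at h
    rwa [inv_pow, ← div_eq_mul_inv, le_div_iff₀ (by positivity)]
  obtain ⟨M, R, hR, hc⟩ := exists_norm_momentCoeff_le hδ hm (A := Acoef) (b := bcoef)
    (K := K₁ + K₂) (q := (r / 2)⁻¹) (by positivity) (by positivity)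
    (fun p i j => hscale ((norm_le_pi_norm _ j).trans ((norm_le_pi_norm _ i).trans
      ((hA p).trans (le_add_of_nonneg_right hK₂)))))
    (fun p => (pi_norm_le_iff_of_nonneg (by positivity)).2 fun i =>
      hscale ((norm_le_pi_norm _ i).trans ((hb p).trans (le_add_of_nonneg_left hK₁)))) y₀
  set c := momentCoeff m Acoef bcoef y₀ with hcdef
  have hbound (i : Fin n) (p : ℕ) (z : ℂ) (hz : z ∈ Metric.ball (0 : ℂ) (min r (1 / (2 * R)))) :
      ‖c p i * z ^ p‖ ≤ M * (1 / 2) ^ p := by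
    have hz' : ‖z‖ ≤ 1 / (2 * R) := (mem_ball_zero_iff.1 hz).le.trans (min_le_right _ _)
    calc ‖c p i * z ^ p‖ ≤ (M * R ^ p) * (1 / (2 * R)) ^ p := by
          rw [norm_mul, norm_pow]
          have hcp := (norm_le_pi_norm (c p) i).trans (hc p)
          exact mul_le_mul hcp (pow_le_pow_left₀ (norm_nonneg z) hz' p) (by positivity)
            ((norm_nonneg _).trans hcp)
      _ = M * (1 / 2) ^ p := by
          rw [mul_assoc, ← mul_pow]
          congr 2
          field_simp
  have hsummable : Summable fun p : ℕ => M * (1 / 2 : ℝ) ^ p := summable_geometric_two.mul_left M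
  have hsum : ∀ z ∈ Metric.ball (0 : ℂ) (min r (1 / (2 * R))), ∀ i,
      HasSum (fun p => c p i * z ^ p) (∑' p, c p i * z ^ p) := fun z hz i =>
    (hsummable.of_norm_bounded fun p => hbound i p z hz).hasSum
  obtain ⟨hc0, hcrec⟩ := (eq_momentCoeff_iff hmpos).1 hcdef
  refine ⟨min r (1 / (2 * R)), by positivity, min_le_left _ _, fun z i => ∑' p, c p i * z ^ p,
    ⟨c, hc0, hcrec, hsum⟩, fun i => ?_, ?_⟩
  · refine DifferentiableOn.analyticOnNhd ?_ Metric.isOpen_ball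
    exact Complex.differentiableOn_tsum_of_summable_norm hsummable
      (fun p => by fun_prop) Metric.isOpen_ball (fun p z hz => hbound i p z hz)
  · rintro y' ⟨c', hc'0, hc'rec, hy'⟩ z hz
    obtain rfl : c' = c := (eq_momentCoeff_iff hmpos).2 ⟨hc'0, hc'rec⟩
    exact funext fun i => (hy' z hz i).unique (hsum z hz i)
end

section
/- Let m = (m_p)_{p≥0} be a sequence of positive real numbers with m_0 = 1 for which there exist α, C > 0 with m_{p+1}/m_p ≥ C (p+1)^α for all p ≥ 0. Let k be a positive integer, A ∈ ℂ^{n×n}, y_0 ∈ ℂ^n, and let y(z) = ∑_{p≥0} (∏_{j=1}^{p} m_{j(k+1)−1}/m_{j(k+1)}) A^p y_0 z^{(k+1)p} be the entire solution of ∂_m y = z^k A y, y(0) = y_0. Then there exist constants c_1, c_2 > 0 such that ‖y(z)‖ ≤ c_1 exp(c_2 |z|^{(k+1)/α}) for all z ∈ ℂ, where ‖·‖ denotes the supremum norm on ℂ^n. -/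
open scoped BigOperators

/-- The powers of a complex matrix grow at most geometrically in the supremum norm. -/
theorem exists_norm_pow_mulVec_le {n : ℕ} (A : Matrix (Fin n) (Fin n) ℂ) :
    ∃ a : ℝ, 0 < a ∧ ∀ (v : Fin n → ℂ) (p : ℕ), ‖(A ^ p).mulVec v‖ ≤ a ^ p * ‖v‖ := by
  let L := LinearMap.toContinuousLinearMap A.mulVecLin
  refine ⟨‖L‖ + 1, by positivity, fun v p => ?_⟩
  induction p with
  | zero => simp
  | succ p ih =>
    have hL : ‖A.mulVec ((A ^ p).mulVec v)‖ ≤ ‖L‖ * ‖(A ^ p).mulVec v‖ :=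
      L.le_opNorm ((A ^ p).mulVec v)
    rw [pow_succ', ← Matrix.mulVec_mulVec, pow_succ', mul_assoc]
    exact hL.trans (mul_le_mul (by linarith) ih (norm_nonneg _) (by positivity))

/-- The lower bound on the quotients of `m` bounds the coefficients of the solution. -/
theorem prod_moment_ratio_le {m : ℕ → ℝ} (hmpos : ∀ p, 0 < m p) {α C : ℝ} (hα : 0 < α)
    (hC : 0 < C) (hgrow : ∀ p : ℕ, C * ((p : ℝ) + 1) ^ α ≤ m (p + 1) / m p) (k p : ℕ) :
    ∏ j ∈ Finset.range p, m ((j + 1) * (k + 1) - 1) / m ((j + 1) * (k + 1)) ≤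
      C⁻¹ ^ p * (((p.factorial : ℕ) : ℝ) ^ α)⁻¹ := by
  induction p with
  | zero => simp
  | succ p ih =>
    obtain ⟨N, hN, hpN⟩ : ∃ N, (p + 1) * (k + 1) = N + 1 ∧ p ≤ N :=
      ⟨p * k + p + k, by ring, by nlinarith [Nat.zero_le (p * k)]⟩
    have hpN' : (p : ℝ) ≤ N := by exact_mod_cast hpN
    have hratio : m N / m (N + 1) ≤ C⁻¹ * (((p : ℝ) + 1) ^ α)⁻¹ := by
      rw [← inv_div, ← mul_inv]
      refine inv_anti₀ (by positivity) (le_trans ?_ (hgrow N))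
      gcongr
    rw [Finset.prod_range_succ, hN, Nat.add_sub_cancel]
    calc _ ≤ (C⁻¹ ^ p * (((p.factorial : ℕ) : ℝ) ^ α)⁻¹) * (C⁻¹ * (((p : ℝ) + 1) ^ α)⁻¹) :=
          mul_le_mul ih hratio (div_pos (hmpos _) (hmpos _)).le (by positivity)
      _ = _ := by
          rw [Nat.factorial_succ, Nat.cast_mul, Nat.cast_succ,
            Real.mul_rpow (by positivity) (by positivity), mul_inv]
          ring

/-- Each term of a Mittag-Leffler-type series is bounded by a geometric term times an
exponential. -/
theorem pow_mul_inv_factorial_rpow_le {α X : ℝ} (hα : 0 < α) (hX : 0 ≤ X) (p : ℕ) :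
    X ^ p * (((p.factorial : ℕ) : ℝ) ^ α)⁻¹ ≤
      Real.exp (2 * α * X ^ (1 / α)) * ((2 : ℝ)⁻¹ ^ α) ^ p := by
  set Y := X ^ (1 / α) with hY
  have hY0 : 0 ≤ Y := by positivity
  have hXY : X = Y ^ α := by
    rw [hY, ← Real.rpow_mul hX, one_div_mul_cancel hα.ne', Real.rpow_one]
  have hpow : ∀ t : ℝ, 0 ≤ t → (t ^ α) ^ p = (t ^ p) ^ α := fun t ht => by
    rw [← Real.rpow_natCast, ← Real.rpow_mul ht, mul_comm, Real.rpow_mul ht, Real.rpow_natCast]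
  have hexp : Real.exp (2 * α * Y) = Real.exp (2 * Y) ^ α := by
    rw [← Real.exp_mul]
    ring_nf
  have hfac : (0 : ℝ) < (p.factorial : ℕ) := by exact_mod_cast p.factorial_pos
  rw [hexp, hXY, hpow Y hY0, hpow _ (by positivity), ← Real.inv_rpow hfac.le,
    ← Real.mul_rpow (by positivity) (by positivity),
    ← Real.mul_rpow (by positivity) (by positivity)]
  refine Real.rpow_le_rpow (by positivity) ?_ hα.le
  calc Y ^ p * ((p.factorial : ℕ) : ℝ)⁻¹
      = (2 * Y) ^ p / (p.factorial : ℕ) * (2 : ℝ)⁻¹ ^ p := by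
        rw [mul_pow, inv_pow]
        field_simp
    _ ≤ _ := by
        gcongr
        exact Real.pow_div_factorial_le_exp _ (by positivity) p

/-- if `m (p+1) / m p ≥ C (p+1)^α` for some `α, C > 0`, then the entire
solution `y(z) = ∑_{p≥0} (∏_{j=1}^p m_{j(k+1)-1}/m_{j(k+1)}) A^p y₀ z^{(k+1)p}` of
`∂ₘ y = z^k A y`, `y(0) = y₀`, satisfies `‖y(z)‖ ≤ c₁ exp(c₂ |z|^((k+1)/α))` on `ℂ`,
for some constants `c₁, c₂ > 0`, where `‖·‖` is the sup norm on `ℂⁿ`. -/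
theorem statement8 (n : ℕ) (m : ℕ → ℝ) (hmpos : ∀ p, 0 < m p) (hm0 : m 0 = 1)
    (α C : ℝ) (hα : 0 < α) (hC : 0 < C)
    (hgrow : ∀ p : ℕ, C * ((p : ℝ) + 1) ^ α ≤ m (p + 1) / m p)
    (k : ℕ) (hk : 0 < k) (A : Matrix (Fin n) (Fin n) ℂ) (y₀ : Fin n → ℂ) :
    let y : ℂ → Fin n → ℂ := fun z => ∑' p : ℕ,
      z ^ ((k + 1) * p) •
        ((((∏ j ∈ Finset.range p, m ((j + 1) * (k + 1) - 1) / m ((j + 1) * (k + 1)) : ℝ)) : ℂ) •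
          ((A ^ p).mulVec y₀))
    ∃ c₁ c₂ : ℝ, 0 < c₁ ∧ 0 < c₂ ∧
      ∀ z : ℂ, ‖y z‖ ≤ c₁ * Real.exp (c₂ * ‖z‖ ^ (((k : ℝ) + 1) / α)) := by
  intro y
  obtain ⟨a, ha, hA⟩ := exists_norm_pow_mulVec_le A
  set q : ℝ := (2 : ℝ)⁻¹ ^ α
  have hq0 : 0 ≤ q := by positivity
  have hq1 : q < 1 := Real.rpow_lt_one (by norm_num) (by norm_num) hα
  have hq1' : 0 < 1 - q := sub_pos.2 hq1
  set B : ℝ := a * C⁻¹ with hB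
  have hB0 : 0 < B := by positivity
  refine ⟨(‖y₀‖ + 1) * (1 - q)⁻¹, 2 * α * B ^ (1 / α), by positivity, by positivity, fun z => ?_⟩
  set E : ℝ := Real.exp (2 * α * B ^ (1 / α) * ‖z‖ ^ (((k : ℝ) + 1) / α)) with hE
  have hXE : Real.exp (2 * α * (B * ‖z‖ ^ (k + 1)) ^ (1 / α)) = E := by
    rw [hE, Real.mul_rpow hB0.le (by positivity), ← Real.rpow_natCast ‖z‖,
      ← Real.rpow_mul (norm_nonneg z), mul_one_div, Nat.cast_succ, ← mul_assoc]
  have hsum : HasSum (fun p : ℕ => (‖y₀‖ * E) * q ^ p) ((‖y₀‖ * E) * (1 - q)⁻¹) :=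
    (hasSum_geometric_of_lt_one hq0 hq1).mul_left _
  refine (tsum_of_norm_bounded hsum fun p => ?_).trans ?_
  · have hprod : 0 ≤ ∏ j ∈ Finset.range p, m ((j + 1) * (k + 1) - 1) / m ((j + 1) * (k + 1)) :=
      Finset.prod_nonneg fun j _ => (div_pos (hmpos _) (hmpos _)).le
    rw [norm_smul, norm_smul, norm_pow, Complex.norm_real, Real.norm_of_nonneg hprod]
    calc _ ≤ ‖z‖ ^ ((k + 1) * p) *
          ((C⁻¹ ^ p * (((p.factorial : ℕ) : ℝ) ^ α)⁻¹) * (a ^ p * ‖y₀‖)) := by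
          gcongr
          · exact prod_moment_ratio_le hmpos hα hC hgrow k p
          · exact hA y₀ p
      _ = ‖y₀‖ * ((B * ‖z‖ ^ (k + 1)) ^ p * (((p.factorial : ℕ) : ℝ) ^ α)⁻¹) := by
          rw [hB, mul_pow, mul_pow, pow_mul]
          ring
      _ ≤ ‖y₀‖ * (E * q ^ p) := by
          rw [← hXE]
          exact mul_le_mul_of_nonneg_left
            (pow_mul_inv_factorial_rpow_le hα (mul_nonneg hB0.le (by positivity)) p)
            (norm_nonneg y₀)
      _ = _ := by ring
  · rw [mul_right_comm]
    gcongr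
    linarith
end

section
/- Let m = (m_p)_{p≥0} be a sequence of positive real numbers with m_0 = 1, let λ_1,…,λ_r ∈ ℂ be pairwise distinct, and let ℓ_1,…,ℓ_r be positive integers. Then the family of formal power series {Δ_{k−1} E(λ_j, z) : 1 ≤ j ≤ r, 1 ≤ k ≤ ℓ_j} is linearly independent over ℂ in ℂ[[z]]. -/
open scoped BigOperators

/-- The formal power series `Δ_h E(λ,z) = ∑_{p≥h} binom(p,h) λ^(p-h) z^p / m_p`
(note `Nat.choose p h = 0` for `p < h`). -/
noncomputable def deltaE (m : ℕ → ℝ) (lam : ℂ) (h : ℕ) : PowerSeries ℂ :=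
  PowerSeries.mk fun p => (p.choose h : ℂ) * lam ^ (p - h) / (m p : ℂ)

open Polynomial in
theorem Polynomial.coeff_taylor_X_sub_C_pow_mul {R : Type*} [CommRing R] (a : R) (n k : ℕ)
    (Q : R[X]) :
    (taylor a ((X - C a) ^ n * Q)).coeff k = if n ≤ k then (taylor a Q).coeff (k - n) else 0 := by
  have h : taylor a ((X - C a) ^ n * Q) = X ^ n * taylor a Q := by
    simp [taylor_mul, taylor_pow]
  rw [h, coeff_X_pow_mul']

open Polynomial in
/-- The Hermite interpolation functionals, sending a polynomial to its Taylor coefficients of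
order `< ℓ j` at pairwise distinct points `a j`, are linearly independent. -/
theorem Polynomial.linearIndependent_lcoeff_comp_taylor {K ι : Type*} [Field K] [Fintype ι]
    (a : ι → K) (ha : Function.Injective a) (ℓ : ι → ℕ) :
    LinearIndependent K
      (fun jk : Σ j : ι, Fin (ℓ j) => (lcoeff K (jk.2 : ℕ)).comp (taylor (a jk.1))) := by
  classical
  rw [Fintype.linearIndependent_iff]
  rintro g hg ⟨j, k⟩
  induction hd : ℓ j - (k : ℕ) using Nat.strong_induction_on generalizing k with
  | _ d ih =>
  set Q : K[X] := ∏ i ∈ Finset.univ.erase j, (X - C (a i)) ^ ℓ i with hQ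
  have hQj : Q.eval (a j) ≠ 0 := by
    rw [hQ, eval_prod, Finset.prod_ne_zero_iff]
    intro i hi
    simpa [sub_eq_zero] using fun h => absurd (ha h).symm (Finset.ne_of_mem_erase hi)
  have hL := LinearMap.congr_fun hg ((X - C (a j)) ^ (k : ℕ) * Q)
  simp only [LinearMap.sum_apply, LinearMap.smul_apply, LinearMap.comp_apply, lcoeff_apply,
    LinearMap.zero_apply, smul_eq_mul] at hL
  rw [Finset.sum_eq_single ⟨j, k⟩ _ (by simp)] at hL
  · rw [coeff_taylor_X_sub_C_pow_mul] at hL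
    simpa [taylor_coeff_zero, hQj] using hL
  · rintro ⟨i, n⟩ - hne
    by_cases hij : i = j
    · subst hij
      rw [coeff_taylor_X_sub_C_pow_mul]
      rcases lt_trichotomy (k : ℕ) (n : ℕ) with h | h | h
      · rw [ih (ℓ i - n) (by omega) n rfl, zero_mul]
      · exact absurd (by rw [Fin.ext h]) hne
      · rw [if_neg (not_le.2 h), mul_zero]
    · have hdvd : (X - C (a i)) ^ ℓ i ∣ (X - C (a j)) ^ (k : ℕ) * Q :=
        Dvd.dvd.mul_left (Finset.dvd_prod_of_mem (fun i => (X - C (a i)) ^ ℓ i)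
          (Finset.mem_erase.2 ⟨hij, Finset.mem_univ i⟩)) _
      obtain ⟨R, hR⟩ := hdvd
      simp only [hR]
      rw [coeff_taylor_X_sub_C_pow_mul, if_neg (by omega), mul_zero]

/-- for pairwise distinct `λ_1, …, λ_r ∈ ℂ` and positive integers
`ℓ_1, …, ℓ_r`, the family `{Δ_{k-1} E(λ_j, z) : 1 ≤ j ≤ r, 1 ≤ k ≤ ℓ_j}` is linearly
independent over `ℂ` in `ℂ[[z]]`. -/
theorem statement18 (m : ℕ → ℝ) (hmpos : ∀ p, 0 < m p) (hm0 : m 0 = 1)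
    (r : ℕ) (lam : Fin r → ℂ) (hlam : Function.Injective lam)
    (ℓ : Fin r → ℕ) (hℓpos : ∀ j, 0 < ℓ j) :
    LinearIndependent ℂ
      (fun jk : Σ j : Fin r, Fin (ℓ j) => deltaE m (lam jk.1) (jk.2 : ℕ)) := by
  have hind := Polynomial.linearIndependent_lcoeff_comp_taylor lam hlam ℓ
  rw [Fintype.linearIndependent_iff] at hind ⊢
  intro g hg
  refine hind g (Polynomial.lhom_ext' fun p => LinearMap.ext_ring ?_)
  have hp := congrArg (PowerSeries.coeff p) hg
  have hm : (m p : ℂ) ≠ 0 := by exact_mod_cast (hmpos p).ne'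
  simp only [deltaE, map_sum, map_smul, PowerSeries.coeff_mk, smul_eq_mul, map_zero,
    ← mul_div_assoc, ← Finset.sum_div, div_eq_zero_iff, hm, or_false] at hp
  simpa [Polynomial.coeff_X_add_C_pow, mul_comm] using hp
end
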